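/- arXiv:2511.15502 — 3 statements merged into one kernel-verified Lean document; each statement's English description precedes it below -/
import Mathlib

section
/- Let q be a prime power, e = gcd(2,q-1), and m ≥ 3 an integer dividing (q-1)/e or (q+1)/e. Then PSL(2,q) has exactly φ(m)/2 conjugacy classes of elements of order m, where φ is Euler's totient function. -/
open Matrix in
lemma aux_form {F : Type} [Field F] [Fintype F] (c e f : F) (h : e ^ 2 - 4 * c * f ≠ 0) :
    ∃ x y : F, c * x ^ 2 + e * x * y + f * y ^ 2 = 1 := by
  by_cases hc : c = 0
  · subst hc
    have he : e ≠ 0 := by rintro rfl; simp at h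
    exact ⟨(1 - f) / e, 1, by field_simp; ring⟩
  by_cases h2 : ringChar F = 2
  · obtain ⟨s, hs⟩ := FiniteField.isSquare_of_char_two h2 c
    have hs0 : s ≠ 0 := by rintro rfl; simp at hs; exact hc hs
    exact ⟨1 / s, 0, by rw [hs]; field_simp; ring⟩
  · have hodd := FiniteField.odd_card_of_char_ne_two h2
    have h20 : (2 : F) ≠ 0 := Ring.two_ne_zero h2
    open Polynomial in
    obtain ⟨a, b, hab⟩ := FiniteField.exists_root_sum_quadratic (R := F) (f := X ^ 2)
      (g := C (-(e ^ 2 - 4 * c * f)) * X ^ 2 + C 0 * X + C (-(4 * c))) (degree_X_pow 2)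
      (degree_quadratic (neg_ne_zero.mpr h)) hodd
    simp at hab
    refine ⟨(a - e * b) / (2 * c), b, ?_⟩
    field_simp
    linear_combination hab

lemma aux_compDet {F : Type} [Field F] (t : F) : (!![0, -1; 1, t] : Matrix (Fin 2) (Fin 2) F).det = 1 := by
  simp [Matrix.det_fin_two]

/-- The companion matrix with trace `t` and determinant one. -/
def compM {F : Type} [Field F] (t : F) : Matrix.SpecialLinearGroup (Fin 2) F :=
  ⟨!![0, -1; 1, t], aux_compDet t⟩

lemma aux_tr_comp {F : Type} [Field F] (t : F) : (compM t).1.trace = t := by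
  simp [compM, Matrix.trace_fin_two]

lemma aux_conj_comp {F : Type} [Field F] [Fintype F] (A : Matrix.SpecialLinearGroup (Fin 2) F)
    (h : A.1.trace ^ 2 ≠ 4) : IsConj (compM A.1.trace) A := by
  have hd := A.2
  rw [Matrix.det_fin_two] at hd
  rw [Matrix.trace_fin_two] at h
  obtain ⟨x, y, hxy⟩ := aux_form (A.1 1 0) (A.1 1 1 - A.1 0 0) (-A.1 0 1) (by
    intro h0; apply h; linear_combination h0 + 4 * hd)
  let P : Matrix.SpecialLinearGroup (Fin 2) F :=
    ⟨!![x, A.1 0 0 * x + A.1 0 1 * y; y, A.1 1 0 * x + A.1 1 1 * y], by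
      simp [Matrix.det_fin_two]; linear_combination hxy⟩
  rw [isConj_iff]
  refine ⟨P, ?_⟩
  rw [mul_inv_eq_iff_eq_mul]
  apply Subtype.ext
  rw [Matrix.SpecialLinearGroup.coe_mul, Matrix.SpecialLinearGroup.coe_mul]
  ext i j
  fin_cases i <;> fin_cases j <;>
    simp [P, compM, Matrix.mul_apply, Fin.sum_univ_two, Matrix.trace_fin_two]
  · linear_combination x * hd
  · linear_combination y * hd

lemma aux_mk_one {F : Type} [Field F] (A : Matrix.SpecialLinearGroup (Fin 2) F) :
    (A : Matrix.ProjectiveSpecialLinearGroup (Fin 2) F) = 1 ↔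
      ∃ r : F, A.1 = Matrix.scalar (Fin 2) r := by
  rw [QuotientGroup.eq_one_iff, Matrix.SpecialLinearGroup.mem_center_iff]
  constructor
  · rintro ⟨r, -, h⟩; exact ⟨r, h.symm⟩
  · rintro ⟨r, h⟩
    refine ⟨r, ?_, h.symm⟩
    have := A.2
    rw [h] at this
    simpa using this

lemma aux_mk_eq {F : Type} [Field F] (A B : Matrix.SpecialLinearGroup (Fin 2) F) :
    (A : Matrix.ProjectiveSpecialLinearGroup (Fin 2) F) = B ↔ B = A ∨ B = -A := by
  rw [QuotientGroup.eq, Matrix.SpecialLinearGroup.mem_center_iff]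
  constructor
  · rintro ⟨r, h1, h⟩
    rw [Fintype.card_fin] at h1
    rcases (mul_self_eq_one_iff.mp ((sq r).symm.trans h1)) with rfl | rfl
    · left
      have : A⁻¹ * B = 1 := Subtype.ext (by rw [← h]; simp)
      exact (inv_mul_eq_one.mp this).symm
    · right
      have : A⁻¹ * B = -1 := Subtype.ext (by
        rw [← h, Matrix.SpecialLinearGroup.coe_neg, map_neg]; simp)
      rw [inv_mul_eq_iff_eq_mul.mp this, mul_neg, mul_one]
  · rintro (rfl | rfl)
    · exact ⟨1, by simp, by simp⟩
    · refine ⟨-1, by simp, ?_⟩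
      rw [mul_neg, inv_mul_cancel, Matrix.SpecialLinearGroup.coe_neg, map_neg]; simp

lemma aux_conj_psl {F : Type} [Field F] [Fintype F] (A B : Matrix.SpecialLinearGroup (Fin 2) F)
    (h : A.1.trace ^ 2 ≠ 4) :
    IsConj (A : Matrix.ProjectiveSpecialLinearGroup (Fin 2) F) B ↔
      A.1.trace ^ 2 = B.1.trace ^ 2 := by
  constructor
  · intro hc
    obtain ⟨P, hP⟩ := isConj_iff.mp hc
    obtain ⟨P, rfl⟩ := QuotientGroup.mk_surjective P
    rw [← QuotientGroup.mk_inv, ← QuotientGroup.mk_mul, ← QuotientGroup.mk_mul, aux_mk_eq] at hP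
    have key : (P * A * P⁻¹).1.trace = A.1.trace := by
      rw [Matrix.SpecialLinearGroup.coe_mul, Matrix.trace_mul_comm,
        ← Matrix.SpecialLinearGroup.coe_mul]
      have : P⁻¹ * (P * A) = A := inv_mul_cancel_left P A
      rw [this]
    rcases hP with rfl | rfl
    · rw [key]
    · rw [Matrix.SpecialLinearGroup.coe_neg, Matrix.trace_neg, key, neg_sq]
  · intro ht
    have main : ∀ C D : Matrix.SpecialLinearGroup (Fin 2) F, C.1.trace ^ 2 ≠ 4 →
        C.1.trace = D.1.trace → IsConj C D := by
      intro C D h1 h2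
      have hC := aux_conj_comp C h1
      have hD := aux_conj_comp D (h2 ▸ h1)
      rw [← h2] at hD
      exact hC.symm.trans hD
    have tr : ∀ C D : Matrix.SpecialLinearGroup (Fin 2) F, IsConj C D →
        IsConj (C : Matrix.ProjectiveSpecialLinearGroup (Fin 2) F) D := fun C D hCD =>
      (QuotientGroup.mk' (Subgroup.center (Matrix.SpecialLinearGroup (Fin 2) F))).map_isConj hCD
    rcases sq_eq_sq_iff_eq_or_eq_neg.mp ht with h1 | h1
    · exact tr _ _ (main A B h h1)
    · have : (B : Matrix.ProjectiveSpecialLinearGroup (Fin 2) F) = ((-B :) :) :=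
        (aux_mk_eq _ _).mpr (Or.inr rfl)
      rw [this]
      exact tr _ _ (main A (-B) h (by
        rw [h1, Matrix.SpecialLinearGroup.coe_neg, Matrix.trace_neg]))

lemma aux_descent {F : Type} [Field F] [Fintype F] (K : Type) [Field K] [Algebra F K] (x : K)
    (hx : x ^ Fintype.card F = x) : ∃ t : F, algebraMap F K t = x := by
  classical
  open Polynomial in
  have hne : (X ^ Fintype.card F - X : K[X]) ≠ 0 :=
    FiniteField.X_pow_card_sub_X_ne_zero K Fintype.one_lt_card
  open Polynomial in
  have hdeg : (X ^ Fintype.card F - X : K[X]).natDegree = Fintype.card F :=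
    FiniteField.X_pow_card_sub_X_natDegree_eq K Fintype.one_lt_card
  open Polynomial in
  have hsub : (Finset.univ : Finset F).image (algebraMap F K) ⊆
      (X ^ Fintype.card F - X : K[X]).roots.toFinset := by
    intro y hy
    obtain ⟨t, -, rfl⟩ := Finset.mem_image.mp hy
    rw [Multiset.mem_toFinset, mem_roots hne]
    simp [IsRoot, ← map_pow, FiniteField.pow_card]
  have heq := Finset.eq_of_subset_of_card_le hsub (by
    rw [Finset.card_image_of_injective _ (algebraMap F K).injective, Finset.card_univ]
    refine (Multiset.toFinset_card_le _).trans ((Polynomial.card_roots' _).trans hdeg.le))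
  have : x ∈ (Finset.univ : Finset F).image (algebraMap F K) := by
    rw [heq, Multiset.mem_toFinset, Polynomial.mem_roots hne]
    simp [Polynomial.IsRoot, hx]
  obtain ⟨t, -, ht⟩ := Finset.mem_image.mp this
  exact ⟨t, ht⟩

/-- scalar powers versus eigenvalues -/
lemma aux_pow {K : Type} [Field K] (A : Matrix (Fin 2) (Fin 2) K) (l : K) (hl : l ≠ 0)
    (hd : A.det = 1) (ht : A.trace = l + l⁻¹) (k : ℕ) :
    (l - l⁻¹) • A ^ k = l ^ k • (A - l⁻¹ • 1) - (l⁻¹) ^ k • (A - l • 1) := by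
  have hCH : A * A = (l + l⁻¹) • A - 1 := by
    have h1 : l * l⁻¹ = 1 := mul_inv_cancel₀ hl
    rw [Matrix.det_fin_two] at hd
    rw [Matrix.trace_fin_two] at ht
    rw [← ht]
    ext i j
    fin_cases i <;> fin_cases j <;> simp [Matrix.mul_apply, Fin.sum_univ_two]
    · linear_combination -hd
    · ring
    · ring
    · linear_combination -hd
  induction k with
  | zero => simp [sub_smul]
  | succ k ih =>
    rw [pow_succ, ← smul_mul_assoc, ih]
    simp only [sub_mul, smul_mul_assoc, hCH, one_mul, pow_succ, smul_sub, smul_smul,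
      add_smul]
    have h1 : l * l⁻¹ = 1 := mul_inv_cancel₀ hl
    have h2 : l ^ k * l * l⁻¹ = l ^ k := by rw [mul_assoc, h1, mul_one]
    have h3 : l⁻¹ ^ k * l⁻¹ * l = l⁻¹ ^ k := by rw [mul_assoc, mul_comm l⁻¹, h1, mul_one]
    rw [h2, h3]
    module

lemma aux_orderOf {F : Type} [Field F] {K : Type} [Field K] [Algebra F K]
    (A : Matrix.SpecialLinearGroup (Fin 2) F) (l : K) (hl : l ≠ 0)
    (ht : algebraMap F K A.1.trace = l + l⁻¹) (hl2 : l ^ 2 ≠ 1) :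
    orderOf (A : Matrix.ProjectiveSpecialLinearGroup (Fin 2) F) = orderOf (l ^ 2) := by
  rw [orderOf_eq_orderOf_iff]
  intro k
  rw [← QuotientGroup.mk_pow, aux_mk_one]
  have h1 : l * l⁻¹ = 1 := mul_inv_cancel₀ hl
  have hne : l - l⁻¹ ≠ 0 := by
    intro h0; apply hl2; linear_combination l * h0 + h1
  set B : Matrix (Fin 2) (Fin 2) K := A.1.map (algebraMap F K) with hB
  have hBd : B.det = 1 := by
    have := (RingHom.map_det (algebraMap F K) A.1).symm
    rw [A.2, map_one] at this; exact this
  have hBt : B.trace = l + l⁻¹ := by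
    rw [← ht, hB]; simp [Matrix.trace_fin_two]
  have hpow := aux_pow B l hl hBd hBt k
  have hBk : B ^ k = (A ^ k).1.map (algebraMap F K) := by
    rw [Matrix.SpecialLinearGroup.coe_pow, hB]
    exact (map_pow (RingHom.mapMatrix (algebraMap F K)) A.1 k).symm
  have hoff : ∀ i j, (l - l⁻¹) * (B ^ k) i j =
      l ^ k * (B i j - l⁻¹ * (1 : Matrix (Fin 2) (Fin 2) K) i j) -
      l⁻¹ ^ k * (B i j - l * (1 : Matrix (Fin 2) (Fin 2) K) i j) := by
    intro i j
    have := congrFun (congrFun hpow i) j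
    simpa using this
  have h00 := hoff 0 0
  have h01 := hoff 0 1
  have h10 := hoff 1 0
  have h11 := hoff 1 1
  simp only [hBk, Matrix.map_apply, Matrix.one_apply_eq, ne_eq, zero_ne_one, not_false_eq_true,
    Matrix.one_apply_ne, one_ne_zero, mul_zero, sub_zero] at h00 h01 h10 h11
  have hkk : l ^ k * l⁻¹ ^ k = 1 := by rw [← mul_pow, h1, one_pow]
  have hiff : (l ^ 2) ^ k = 1 ↔ l ^ k - l⁻¹ ^ k = 0 := by
    rw [← pow_mul, mul_comm, pow_mul]
    constructor
    · intro h
      linear_combination l⁻¹ ^ k * h - l ^ k * hkk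
    · intro h
      linear_combination l ^ k * h + hkk
  rw [hiff]
  constructor
  · rintro ⟨r, hr⟩
    by_contra hk
    change (A ^ k).1 = _ at hr
    rw [hr] at h00 h01 h10 h11
    simp at h00 h01 h10 h11
    have e01 : B 0 1 = 0 := by
      have : (l ^ k - l⁻¹ ^ k) * B 0 1 = 0 := by linear_combination -h01
      exact (mul_eq_zero.mp this).resolve_left hk
    have ed : B 0 0 = B 1 1 := by
      have : (l ^ k - l⁻¹ ^ k) * (B 0 0 - B 1 1) = 0 := by linear_combination h11 - h00
      exact sub_eq_zero.mp ((mul_eq_zero.mp this).resolve_left hk)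
    rw [Matrix.det_fin_two, e01, ed] at hBd
    rw [Matrix.trace_fin_two, ed] at hBt
    have : (l - l⁻¹) ^ 2 = 0 := by
      linear_combination 4 * hBd - (B 1 1 + B 1 1 + l + l⁻¹) * hBt - 4 * h1
    exact hne (pow_eq_zero_iff (two_ne_zero) |>.mp this)
  · intro hk
    have inj := (algebraMap F K).injective
    refine ⟨(A ^ k).1 0 0, ?_⟩
    have e01 : (A ^ k).1 0 1 = 0 := inj (by
      rw [map_zero]
      refine (mul_eq_zero.mp (?_ : (l - l⁻¹) * _ = 0)).resolve_left hne
      linear_combination h01 + B 0 1 * hk)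
    have e10 : (A ^ k).1 1 0 = 0 := inj (by
      rw [map_zero]
      refine (mul_eq_zero.mp (?_ : (l - l⁻¹) * _ = 0)).resolve_left hne
      linear_combination h10 + B 1 0 * hk)
    have e11 : (A ^ k).1 1 1 = (A ^ k).1 0 0 := inj (by
      apply mul_left_cancel₀ hne
      linear_combination h11 - h00 + (B 1 1 - B 0 0) * hk)
    ext i j
    fin_cases i <;> fin_cases j <;> simp [e01, e10, e11]

lemma aux_unip {F : Type} [Field F] (p : ℕ) [Fact p.Prime] [CharP F p]
    (A : Matrix.SpecialLinearGroup (Fin 2) F) (h : A.1.trace ^ 2 = 4) :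
    (A : Matrix.ProjectiveSpecialLinearGroup (Fin 2) F) ^ p = 1 := by
  have hd := A.2
  rw [Matrix.det_fin_two] at hd
  have : ∃ s : F, A.1.trace = 2 * s ∧ s ^ 2 = 1 := by
    rcases sq_eq_sq_iff_eq_or_eq_neg.mp (h.trans (by norm_num : (4 : F) = 2 ^ 2)) with h | h
    · exact ⟨1, by simp [h]⟩
    · exact ⟨-1, by simp [h]⟩
  obtain ⟨s, hs, hs1⟩ := this
  rw [← QuotientGroup.mk_pow, aux_mk_one]
  refine ⟨s ^ p, ?_⟩
  rw [Matrix.SpecialLinearGroup.coe_pow]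
  have hnil : (A.1 - Matrix.scalar (Fin 2) s) ^ 2 = 0 := by
    rw [Matrix.trace_fin_two] at hs
    ext i j
    fin_cases i <;> fin_cases j <;> simp [pow_two, Matrix.mul_apply, Fin.sum_univ_two]
    · linear_combination -hd + hs1 + A.1 0 0 * hs
    · linear_combination A.1 0 1 * hs
    · linear_combination A.1 1 0 * hs
    · linear_combination -hd + hs1 + A.1 1 1 * hs
  have hp2 : 2 ≤ p := (Fact.out : p.Prime).two_le
  have hcomm : Commute A.1 (Matrix.scalar (Fin 2) s) :=
    (Matrix.scalar_commute s (Commute.all s) A.1).symm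
  have := sub_pow_char_of_commute p hcomm
  rw [pow_eq_zero_of_le hp2 hnil] at this
  rw [map_pow]
  exact (sub_eq_zero.mp this.symm)

lemma aux_card {α β : Type} (s : Finset α) [Fintype β] [DecidableEq β] (f : α → β)
    (hf : ∀ b, (s.filter (fun a => f a = b)).card = 2) : Nat.card β = s.card / 2 := by
  have := Finset.card_eq_sum_card_fiberwise (f := f) (s := s) (t := Finset.univ) (by simp)
  simp only [hf, Finset.sum_const, smul_eq_mul, Finset.card_univ] at this
  rw [Nat.card_eq_fintype_card]; omega

lemma aux_e_dvd (q : ℕ) (hq : 1 ≤ q) :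
    (Nat.gcd 2 (q - 1) = 2 ∧ q % 2 = 1) ∨ (Nat.gcd 2 (q - 1) = 1 ∧ q % 2 = 0) := by
  rcases Nat.mod_two_eq_zero_or_one q with h | h
  · right
    refine ⟨?_, h⟩
    rw [← Nat.Coprime, Nat.coprime_two_left, Nat.odd_iff]; omega
  · left
    exact ⟨Nat.gcd_eq_left (by omega), h⟩

lemma aux_not_dvd (p n q m : ℕ) (hp : p.Prime) (hn : n ≠ 0) (hq : q = p ^ n)
    (hdvd : m ∣ (q - 1) / Nat.gcd 2 (q - 1) ∨ m ∣ (q + 1) / Nat.gcd 2 (q - 1)) : ¬ p ∣ m := by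
  intro hpm
  have hq1 : 1 ≤ q := hq ▸ Nat.one_le_pow _ _ hp.pos
  have hpq : p ∣ q := hq ▸ dvd_pow_self p hn
  have h : p ∣ q - 1 ∨ p ∣ q + 1 := by
    have h2 : ∀ a, Nat.gcd 2 (q - 1) ∣ a → m ∣ a / Nat.gcd 2 (q - 1) → p ∣ a := fun a h1 h2 =>
      hpm.trans (h2.trans (Nat.div_dvd_of_dvd h1))
    rcases hdvd with h | h
    · exact Or.inl (h2 _ (Nat.gcd_dvd_right _ _) h)
    · refine Or.inr (h2 _ ?_ h)
      rcases aux_e_dvd q hq1 with ⟨h, h'⟩ | ⟨h, h'⟩ <;> rw [h] <;> omega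
  have : p ∣ 1 := by
    rcases h with h | h
    · have := Nat.dvd_sub hpq h
      rwa [Nat.sub_sub_self hq1] at this
    · exact (Nat.dvd_add_right hpq).mp h
  exact hp.one_lt.ne' (Nat.dvd_one.mp this)

lemma aux_lam {K : Type} [Field K] (p n q m : ℕ) (hp : p.Prime) (hn : n ≠ 0) (hq : q = p ^ n)
    [CharP K p]
    (hdvd : m ∣ (q - 1) / Nat.gcd 2 (q - 1) ∨ m ∣ (q + 1) / Nat.gcd 2 (q - 1))
    (l : K) (hl : l ≠ 0) (hlm : (l ^ 2) ^ m = 1) : (l + l⁻¹) ^ q = l + l⁻¹ := by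
  have : Fact p.Prime := ⟨hp⟩
  have hq1 : 1 ≤ q := hq ▸ Nat.one_le_pow _ _ hp.pos
  have key : ∀ a, Nat.gcd 2 (q - 1) ∣ a → m ∣ a / Nat.gcd 2 (q - 1) → l ^ a = 1 := by
    intro a ha hma
    obtain ⟨c, hc⟩ := hma
    rcases aux_e_dvd q hq1 with ⟨h, h'⟩ | ⟨h, h'⟩
    · rw [h] at hc ha
      have : a = 2 * (m * c) := by omega
      rw [this, pow_mul, pow_mul, hlm, one_pow]
    · rw [h, Nat.div_one] at hc
      have hp2 : p = 2 := by
        have : 2 ∣ p ^ n := by rw [← hq]; omega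
        exact ((Nat.prime_dvd_prime_iff_eq Nat.prime_two hp).mp
          (Nat.prime_two.dvd_of_dvd_pow this)).symm
      subst hp2
      have h2 : (l ^ a) ^ 2 = 1 := by
        rw [← pow_mul, mul_comm, pow_mul, hc, pow_mul, hlm, one_pow]
      have h3 := mul_self_eq_one_iff.mp ((sq (l ^ a)).symm.trans h2)
      rwa [CharTwo.neg_eq, or_self] at h3
  have hadd : (l + l⁻¹) ^ q = l ^ q + (l ^ q)⁻¹ := by
    rw [hq, add_pow_char_pow, inv_pow]
  rw [hadd]
  rcases hdvd with h | h
  · have h1 := key _ (Nat.gcd_dvd_right _ _) h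
    have : l ^ q = l := by
      obtain ⟨r, rfl⟩ : ∃ r, q = r + 1 := ⟨q - 1, by omega⟩
      rw [pow_succ]; simp at h1; rw [h1, one_mul]
    rw [this]
  · have h1 := key (q + 1) (by
      rcases aux_e_dvd q hq1 with ⟨h, h'⟩ | ⟨h, h'⟩ <;> rw [h] <;> omega) h
    have : l ^ q = l⁻¹ := eq_inv_of_mul_eq_one_left (by rw [← pow_succ, h1])
    rw [this, inv_inv, add_comm]

/-- Let `q` be a prime power, `e = gcd(2, q-1)`, and `m ≥ 3` an integer dividing `(q-1)/e` or
`(q+1)/e`. Then `PSL(2,q)` has exactly `φ(m)/2` conjugacy classes of elements of order `m`. -/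
theorem psl_two_card_order_m_classes (p n q : ℕ) (hp : p.Prime) (hn : n ≠ 0)
    (hq : q = p ^ n) (F : Type) [Field F] [Fintype F] (hF : Fintype.card F = q)
    (m : ℕ) (hm : 3 ≤ m)
    (hdvd : m ∣ (q - 1) / Nat.gcd 2 (q - 1) ∨ m ∣ (q + 1) / Nat.gcd 2 (q - 1)) :
    Nat.card {c : ConjClasses (Matrix.ProjectiveSpecialLinearGroup (Fin 2) F) //
        ∃ g, ConjClasses.mk g = c ∧ orderOf g = m} = Nat.totient m / 2 := by
  classical
  have hpF : Fact p.Prime := ⟨hp⟩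
  have hchar : CharP F p := by
    obtain ⟨r, hr⟩ := CharP.exists F
    obtain ⟨k, hrp, hk⟩ := FiniteField.card F r
    have h1 : r ∣ p ^ n := by
      rw [← hq, ← hF, hk]; exact dvd_pow_self r k.ne_zero
    have h2 := (Nat.prime_dvd_prime_iff_eq hrp hp).mp (hrp.dvd_of_dvd_pow h1)
    exact h2 ▸ hr
  have hpm := aux_not_dvd p n q m hp hn hq hdvd
  let K := AlgebraicClosure F
  have hcharK : CharP K p := charP_of_injective_algebraMap (algebraMap F K).injective p
  have hmK : NeZero (m : K) := ⟨fun h => hpm ((CharP.cast_eq_zero_iff K p m).mp h)⟩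
  have hmF : NeZero (m : F) := ⟨fun h => hpm ((CharP.cast_eq_zero_iff F p m).mp h)⟩
  obtain ⟨ζ, hζ⟩ := HasEnoughRootsOfUnity.exists_primitiveRoot K m
  rw [← hζ.card_primitiveRoots]
  -- choose `t`
  have hex : ∀ u : K, ∃ t : F, u ∈ primitiveRoots m K →
      algebraMap F K t ^ 2 = u + u⁻¹ + 2 ∧ t ^ 2 ≠ 4 ∧
      orderOf (compM t : Matrix.ProjectiveSpecialLinearGroup (Fin 2) F) = m := by
    intro u
    by_cases hu : u ∈ primitiveRoots m K
    swap
    · exact ⟨0, fun h => absurd h hu⟩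
    have hu' := (mem_primitiveRoots (by omega)).mp hu
    have hu0 : u ≠ 0 := hu'.ne_zero (by omega)
    have hu1 : u ≠ 1 := hu'.ne_one (by omega)
    obtain ⟨l, hl⟩ := IsAlgClosed.exists_pow_nat_eq u (n := 2) (by norm_num)
    have hl0 : l ≠ 0 := by rintro rfl; simp at hl; exact hu0 hl.symm
    obtain ⟨t, ht⟩ := aux_descent K (l + l⁻¹) (by
      rw [hF]
      exact aux_lam p n q m hp hn hq hdvd l hl0 (by rw [hl]; exact hu'.pow_eq_one))
    have h1 : l * l⁻¹ = 1 := mul_inv_cancel₀ hl0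
    refine ⟨t, fun _ => ⟨?_, ?_, ?_⟩⟩
    · rw [ht, ← hl, ← inv_pow]
      linear_combination (2 : K) * h1
    · intro h4
      have h5 := congrArg (algebraMap F K) h4
      rw [map_pow, ht, map_ofNat] at h5
      have h6 : (l - l⁻¹) ^ 2 = 0 := by linear_combination h5 - 4 * h1
      have h7 := (pow_eq_zero_iff two_ne_zero).mp h6
      apply hu1
      rw [← hl]; linear_combination l * h7 + h1
    · rw [aux_orderOf (K := K) (compM t) l hl0 (by rw [aux_tr_comp, ht]) (by rwa [hl]), hl]
      exact hu'.eq_orderOf.symm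
  choose T hT using hex
  have hmem : ∀ u : K, u ∈ primitiveRoots m K → u⁻¹ ∈ primitiveRoots m K := fun u hu =>
    (mem_primitiveRoots (by omega)).mpr ((mem_primitiveRoots (by omega)).mp hu).inv
  let S := {c : ConjClasses (Matrix.ProjectiveSpecialLinearGroup (Fin 2) F) //
        ∃ g, ConjClasses.mk g = c ∧ orderOf g = m}
  have hSfin : Fintype S := Fintype.ofFinite S
  let g : {u : K // u ∈ primitiveRoots m K} → S := fun u =>
    ⟨ConjClasses.mk (compM (T u) : Matrix.ProjectiveSpecialLinearGroup (Fin 2) F),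
      _, rfl, (hT u u.2).2.2⟩
  have hg : ∀ u v, g u = g v ↔ (u.1 = v.1 ∨ u.1 = v.1⁻¹) := by
    rintro ⟨u, hu⟩ ⟨v, hv⟩
    have hu0 : u ≠ 0 := ((mem_primitiveRoots (by omega)).mp hu).ne_zero (by omega)
    have hv0 : v ≠ 0 := ((mem_primitiveRoots (by omega)).mp hv).ne_zero (by omega)
    rw [Subtype.ext_iff]
    simp only [g]
    rw [ConjClasses.mk_eq_mk_iff_isConj, aux_conj_psl _ _ (by
      rw [aux_tr_comp]; exact (hT u hu).2.1), aux_tr_comp, aux_tr_comp,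
      ← (algebraMap F K).injective.eq_iff, map_pow, map_pow, (hT u hu).1, (hT v hv).1]
    have h1 : u * u⁻¹ = 1 := mul_inv_cancel₀ hu0
    have h2 : v * v⁻¹ = 1 := mul_inv_cancel₀ hv0
    constructor
    · intro h
      have : (u - v) * (u - v⁻¹) = 0 := by linear_combination u * h + h2 - h1
      rcases mul_eq_zero.mp this with h | h
      · exact Or.inl (sub_eq_zero.mp h)
      · exact Or.inr (sub_eq_zero.mp h)
    · rintro (rfl | rfl)
      · rfl
      · rw [inv_inv]; ring
  have hsurj : Function.Surjective g := by
    rintro ⟨c, a, rfl, ha⟩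
    obtain ⟨A, rfl⟩ := QuotientGroup.mk_surjective a
    have hA4 : A.1.trace ^ 2 ≠ 4 := by
      intro h4
      have h1 := orderOf_dvd_of_pow_eq_one (aux_unip p A h4)
      rw [ha] at h1
      rcases (Nat.dvd_prime hp).mp h1 with h | h
      · omega
      · exact hpm h.symm.dvd
    obtain ⟨l, hl⟩ : ∃ l : K, l ^ 2 - algebraMap F K A.1.trace * l + 1 = 0 := by
      open Polynomial in
      obtain ⟨l, hl⟩ := IsAlgClosed.exists_root
        (C (1 : K) * X ^ 2 + C (-algebraMap F K A.1.trace) * X + C 1) (by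
          rw [degree_quadratic one_ne_zero]; norm_num)
      refine ⟨l, ?_⟩
      simp [Polynomial.IsRoot] at hl
      linear_combination hl
    have hl0 : l ≠ 0 := by rintro rfl; simp at hl
    have h1 : l * l⁻¹ = 1 := mul_inv_cancel₀ hl0
    have htr : algebraMap F K A.1.trace = l + l⁻¹ := by
      apply mul_left_cancel₀ hl0
      linear_combination -hl - h1
    have hl2 : l ^ 2 ≠ 1 := by
      intro h
      apply hA4
      apply (algebraMap F K).injective
      rw [map_pow, htr, map_ofNat]
      have : l⁻¹ ^ 2 = 1 := by rw [inv_pow, h, inv_one]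
      linear_combination h + this + 2 * h1
    have hord := aux_orderOf A l hl0 htr hl2
    have hprim : l ^ 2 ∈ primitiveRoots m K := by
      rw [mem_primitiveRoots (by omega), IsPrimitiveRoot.iff_orderOf, ← hord]
      exact ha
    refine ⟨⟨l ^ 2, hprim⟩, Subtype.ext ?_⟩
    simp only [g]
    rw [ConjClasses.mk_eq_mk_iff_isConj, aux_conj_psl _ _ (by
      rw [aux_tr_comp]; exact (hT _ hprim).2.1), aux_tr_comp,
      ← (algebraMap F K).injective.eq_iff, map_pow, map_pow, (hT _ hprim).1, htr, ← inv_pow]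
    linear_combination (-2 : K) * h1
  have := aux_card (Finset.univ : Finset {u : K // u ∈ primitiveRoots m K}) g (by
    intro b
    obtain ⟨v, rfl⟩ := hsurj b
    have : (Finset.univ.filter (fun u => g u = g v)) = {v, ⟨v.1⁻¹, hmem _ v.2⟩} := by
      ext u
      simp only [Finset.mem_filter, Finset.mem_univ, true_and, Finset.mem_insert,
        Finset.mem_singleton, hg]
      rw [Subtype.ext_iff, Subtype.ext_iff]
    rw [this, Finset.card_pair]
    intro h
    have h' : v.1 = v.1⁻¹ := congrArg Subtype.val h
    have hv := (mem_primitiveRoots (by omega)).mp v.2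
    have h2 : v.1 ^ 2 = 1 := by
      rw [sq]; nth_rewrite 2 [h']; exact mul_inv_cancel₀ (hv.ne_zero (by omega))
    have := Nat.le_of_dvd (by norm_num) (hv.dvd_of_pow_eq_one 2 h2)
    omega)
  rw [this, Finset.card_univ, Fintype.card_coe]
end

section
/- Let O be a semisimple conjugacy class of PSL(2,q) and m an integer with gcd(m, o(O)) = 1, where o(O) is the common order of the elements of O. Then the set O^[m] = { x^m : x ∈ O } equals O if and only if o(O) divides m-1 or o(O) divides m+1. -/
namespace PslAux

variable {F : Type} [Field F]

/-- Inversion of a regular semisimple matrix by an element of determinant one: scalar form. -/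
theorem exists_entries [Fintype F] (a b c d : F) (hD : (a - d) ^ 2 + 4 * b * c ≠ 0) :
    ∃ x y z : F, x * (a - d) + y * c + z * b = 0 ∧ -x ^ 2 - y * z = 1 := by
  by_cases hb : b = 0
  · subst hb
    have had : a - d ≠ 0 := by
      intro h; apply hD; rw [h]; ring
    by_cases hc : c = 0
    · subst hc
      exact ⟨0, 1, -1, by ring, by ring⟩
    · refine ⟨1, -(a - d) / c, 2 * c / (a - d), ?_, ?_⟩ <;> field_simp <;> ring
  · by_cases h2 : ringChar F = 2
    · have : CharP F 2 := by rw [← h2]; infer_instance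
      have h20 : (2 : F) = 0 := CharTwo.two_eq_zero
      refine ⟨1, 0, -(a - d) / b, ?_, ?_⟩
      · field_simp; ring
      · linear_combination -h20
    · have h20 : (2 : F) ≠ 0 := Ring.two_ne_zero h2
      have hcard : Fintype.card F % 2 = 1 := FiniteField.odd_card_of_char_ne_two h2
      set E : F := ((a - d) ^ 2 + 4 * b * c) / (4 * b) with hE
      have h4 : (4 : F) ≠ 0 := by
        have : (4 : F) = 2 * 2 := by norm_num
        rw [this]; exact mul_ne_zero h20 h20
      have hE0 : E ≠ 0 := div_ne_zero hD (mul_ne_zero h4 hb)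
      obtain ⟨X, y, hXy⟩ := FiniteField.exists_root_sum_quadratic
        (f := Polynomial.C (-b) * Polynomial.X ^ 2 + Polynomial.C 0 * Polynomial.X
          + Polynomial.C (-b))
        (g := Polynomial.C E * Polynomial.X ^ 2 + Polynomial.C 0 * Polynomial.X
          + Polynomial.C 0)
        (Polynomial.degree_quadratic (neg_ne_zero.mpr hb))
        (Polynomial.degree_quadratic hE0) hcard
      simp only [Polynomial.eval_add, Polynomial.eval_mul, Polynomial.eval_C, Polynomial.eval_pow,
        Polynomial.eval_X] at hXy
      have hE' : E * (4 * b) = (a - d) ^ 2 + 4 * b * c := by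
        rw [hE]; field_simp
      have hX2 : ∃ x, 2 * b * x = 2 * b * X + (a - d) * y := by
        refine ⟨X + (a - d) * y / (2 * b), ?_⟩
        field_simp
      obtain ⟨x, hx⟩ := hX2
      refine ⟨x, y, -(x * (a - d) + y * c) / b, ?_, ?_⟩
      · field_simp; ring
      · have key : -b * x ^ 2 + (a - d) * x * y + c * y ^ 2 = b := by
          apply mul_left_cancel₀ (mul_ne_zero h4 hb)
          linear_combination (4 * b) * hXy - y ^ 2 * hE' +
            (-(2 * b * x + 2 * b * X) + (a - d) * y) * hx
        field_simp
        linear_combination key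

/-- Commuting scalar form. -/
theorem exists_lin (A C : Matrix (Fin 2) (Fin 2) F) (h : A * C = C * A)
    (hD : (A 0 0 - A 1 1) ^ 2 + 4 * A 0 1 * A 1 0 ≠ 0) :
    ∃ u v : F, C = u • A + v • (1 : Matrix (Fin 2) (Fin 2) F) := by
  have h00 := congrFun (congrFun h 0) 0
  have h01 := congrFun (congrFun h 0) 1
  have h10 := congrFun (congrFun h 1) 0
  have h11 := congrFun (congrFun h 1) 1
  simp only [Matrix.mul_apply, Fin.sum_univ_two] at h00 h01 h10 h11
  have aux : ∀ u v : F, C 0 0 = u * A 0 0 + v → C 0 1 = u * A 0 1 → C 1 0 = u * A 1 0 →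
      C 1 1 = u * A 1 1 + v → C = u • A + v • (1 : Matrix (Fin 2) (Fin 2) F) := by
    intro u v e1 e2 e3 e4
    ext i j
    fin_cases i <;> fin_cases j <;> simp [e1, e2, e3, e4]
  by_cases hb : A 0 1 = 0
  · have had : A 0 0 - A 1 1 ≠ 0 := by
      intro h; apply hD; rw [h, hb]; ring
    refine ⟨(C 0 0 - C 1 1) / (A 0 0 - A 1 1),
      C 0 0 - (C 0 0 - C 1 1) / (A 0 0 - A 1 1) * A 0 0, aux _ _ ?_ ?_ ?_ ?_⟩
    · ring
    · field_simp
      linear_combination h01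
    · field_simp
      linear_combination -h10
    · field_simp
      ring
  · refine ⟨C 0 1 / A 0 1, C 0 0 - C 0 1 / A 0 1 * A 0 0, aux _ _ ?_ ?_ ?_ ?_⟩
    · ring
    · field_simp
    · field_simp
      linear_combination h00
    · field_simp
      linear_combination h01

theorem four_cases (A C : Matrix (Fin 2) (Fin 2) F) (h : A * C = C * A) (hA : A.det = 1)
    (hC : C.det = 1) (ht : C.trace ^ 2 = A.trace ^ 2) (hD : A.trace ^ 2 ≠ 4) :
    C = A ∨ C = -A ∨ C = A.adjugate ∨ C = -A.adjugate := by
  have hadj : A.adjugate = A.trace • (1 : Matrix (Fin 2) (Fin 2) F) - A := by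
    rw [Matrix.adjugate_fin_two, Matrix.trace_fin_two]
    ext i j
    fin_cases i <;> fin_cases j <;> simp
  rw [Matrix.det_fin_two] at hA hC
  rw [Matrix.trace_fin_two] at hadj
  rw [Matrix.trace_fin_two, Matrix.trace_fin_two] at ht
  rw [Matrix.trace_fin_two] at hD
  have hD' : (A 0 0 - A 1 1) ^ 2 + 4 * A 0 1 * A 1 0 ≠ 0 := by
    intro h0; apply hD; linear_combination h0 + 4 * hA
  obtain ⟨u, v, rfl⟩ := exists_lin A C h hD'
  rw [hadj]
  simp at hC ht
  generalize htt : A 0 0 + A 1 1 = t at *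
  have e1 : u ^ 2 + u * v * t + v ^ 2 = 1 := by
    linear_combination hC - u ^ 2 * hA - u * v * htt
  have e2 : (u * t + 2 * v) ^ 2 = t ^ 2 := by
    rw [← htt] at ht ⊢
    linear_combination ht
  have e3 : (u - 1) * (u + 1) = 0 := by
    have : (t ^ 2 - 4) * ((u - 1) * (u + 1)) = 0 := by
      linear_combination e2 - 4 * e1
    exact (mul_eq_zero.mp this).resolve_left (sub_ne_zero.mpr hD)
  rcases mul_eq_zero.mp e3 with hu | hu
  · have hu : u = 1 := by linear_combination hu
    subst hu
    have : v * (v + t) = 0 := by linear_combination e1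
    rcases mul_eq_zero.mp this with hv | hv
    · left; simp [hv]
    · have hv : v = -t := by linear_combination hv
      right; right; right
      rw [hv]; simp [neg_smul]; abel
  · have hu : u = -1 := by linear_combination hu
    subst hu
    have : v * (v - t) = 0 := by linear_combination e1
    rcases mul_eq_zero.mp this with hv | hv
    · right; left; simp [hv]
    · have hv : v = t := by linear_combination hv
      right; right; left
      rw [hv]; simp; abel

open Matrix

theorem mem_center (A : Matrix.SpecialLinearGroup (Fin 2) F) :
    A ∈ Subgroup.center (Matrix.SpecialLinearGroup (Fin 2) F) ↔ A = 1 ∨ A = -1 := by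
  rw [Matrix.SpecialLinearGroup.mem_center_iff]
  constructor
  · rintro ⟨r, hr, hA⟩
    simp at hr
    rcases hr with rfl | rfl
    · left; ext i j; rw [← hA]; simp
    · right; ext i j; rw [← hA, map_neg, map_one, Matrix.SpecialLinearGroup.coe_neg,
        Matrix.SpecialLinearGroup.coe_one]
  · rintro (rfl | rfl)
    · exact ⟨1, by simp, by simp⟩
    · exact ⟨-1, by simp, by rw [map_neg, map_one, Matrix.SpecialLinearGroup.coe_neg,
        Matrix.SpecialLinearGroup.coe_one]⟩

theorem mk_eq (A B : Matrix.SpecialLinearGroup (Fin 2) F) :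
    ((A : Matrix.SpecialLinearGroup (Fin 2) F ⧸ Subgroup.center (Matrix.SpecialLinearGroup (Fin 2) F)) = B) ↔
      B = A ∨ B = -A := by
  rw [QuotientGroup.eq, mem_center, inv_mul_eq_iff_eq_mul, inv_mul_eq_iff_eq_mul]
  simp

theorem trace_ne (p : ℕ) (hp : p.Prime) [CharP F p] (A : Matrix.SpecialLinearGroup (Fin 2) F)
    (h : (A : Matrix (Fin 2) (Fin 2) F).trace ^ 2 = 4) :
    A ^ p = 1 ∨ A ^ p = -1 := by
  have : Fact p.Prime := ⟨hp⟩
  have hdet := A.det_coe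
  have main : ∃ e : F, e ^ 2 = 1 ∧ (A : Matrix (Fin 2) (Fin 2) F).trace = 2 * e := by
    have : ((A : Matrix (Fin 2) (Fin 2) F).trace - 2) *
      ((A : Matrix (Fin 2) (Fin 2) F).trace + 2) = 0 := by linear_combination h
    rcases mul_eq_zero.mp this with h | h
    · exact ⟨1, by simp, by linear_combination h⟩
    · exact ⟨-1, by simp, by linear_combination h⟩
  obtain ⟨e, he, ht⟩ := main
  set M := (A : Matrix (Fin 2) (Fin 2) F) with hM
  have hsq : (M - scalar (Fin 2) e) ^ 2 = 0 := by
    rw [trace_fin_two] at ht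
    rw [det_fin_two] at hdet
    ext i j
    fin_cases i <;> fin_cases j <;> simp [pow_two, Matrix.mul_apply, Fin.sum_univ_two]
    · linear_combination M 0 0 * ht - hdet + he
    · linear_combination M 0 1 * ht
    · linear_combination M 1 0 * ht
    · linear_combination M 1 1 * ht - hdet + he
  have hp0 : (M - scalar (Fin 2) e) ^ p = 0 := pow_eq_zero_of_le hp.two_le hsq
  have hcomm : Commute M (scalar (Fin 2) e) :=
    (Matrix.scalar_commute e (fun r => Commute.all _ _) M).symm
  rw [sub_pow_char_of_commute p hcomm, sub_eq_zero, ← map_pow] at hp0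
  have : (e ^ p) ^ 2 = 1 := by rw [← pow_mul, mul_comm, pow_mul, he, one_pow]
  apply (mem_center _).mp
  rw [Matrix.SpecialLinearGroup.mem_center_iff]
  exact ⟨e ^ p, by simpa using this, by rw [← hp0]; simp [hM]⟩

theorem conj_inv [Fintype F] (A : Matrix.SpecialLinearGroup (Fin 2) F)
    (hD : (A : Matrix (Fin 2) (Fin 2) F).trace ^ 2 ≠ 4) : IsConj A A⁻¹ := by
  have hA := A.det_coe
  rw [det_fin_two] at hA
  rw [trace_fin_two] at hD
  obtain ⟨x, y, z, h1, h2⟩ := exists_entries (A.1 0 0) (A.1 0 1) (A.1 1 0) (A.1 1 1) (by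
    intro h0; apply hD; linear_combination h0 + 4 * hA)
  rw [isConj_iff]
  have hdet : (!![x, y; z, -x] : Matrix (Fin 2) (Fin 2) F).det = 1 := by
    rw [det_fin_two_of]; linear_combination h2
  obtain ⟨P, hP⟩ : ∃ P : Matrix.SpecialLinearGroup (Fin 2) F,
      (P : Matrix (Fin 2) (Fin 2) F) = !![x, y; z, -x] := ⟨⟨_, hdet⟩, rfl⟩
  refine ⟨P, ?_⟩
  apply mul_inv_eq_iff_eq_mul.mpr
  ext i j
  rw [Matrix.SpecialLinearGroup.coe_mul, Matrix.SpecialLinearGroup.coe_mul, Matrix.SpecialLinearGroup.coe_inv,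
    adjugate_fin_two, hP]
  fin_cases i <;> fin_cases j <;> simp [Matrix.mul_apply, Fin.sum_univ_two]
  · linear_combination h1
  · ring
  · ring
  · linear_combination h1

theorem pow_cases (A : Matrix.SpecialLinearGroup (Fin 2) F) (m : ℤ)
    (hD : (A : Matrix (Fin 2) (Fin 2) F).trace ^ 2 ≠ 4)
    (B : Matrix.SpecialLinearGroup (Fin 2) F) (h : A ^ m = B * A * B⁻¹ ∨ A ^ m = -(B * A * B⁻¹)) :
    A ^ m = A ∨ A ^ m = -A ∨ A ^ m = A⁻¹ ∨ A ^ m = -A⁻¹ := by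
  have htr : ((B * A * B⁻¹ : Matrix.SpecialLinearGroup (Fin 2) F) : Matrix (Fin 2) (Fin 2) F).trace
      = (A : Matrix (Fin 2) (Fin 2) F).trace := by
    rw [Matrix.SpecialLinearGroup.coe_mul, trace_mul_comm, ← Matrix.SpecialLinearGroup.coe_mul,
      inv_mul_cancel_left]
  have ht : ((A ^ m : Matrix.SpecialLinearGroup (Fin 2) F) : Matrix (Fin 2) (Fin 2) F).trace ^ 2
      = (A : Matrix (Fin 2) (Fin 2) F).trace ^ 2 := by
    rcases h with h | h
    · rw [h, htr]
    · rw [h, Matrix.SpecialLinearGroup.coe_neg, trace_neg, htr, neg_sq]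
  have hc : (A : Matrix (Fin 2) (Fin 2) F) * ((A ^ m : Matrix.SpecialLinearGroup (Fin 2) F) : Matrix (Fin 2) (Fin 2) F) = ((A ^ m : Matrix.SpecialLinearGroup (Fin 2) F) : Matrix (Fin 2) (Fin 2) F) * (A : Matrix (Fin 2) (Fin 2) F) := by
    rw [← Matrix.SpecialLinearGroup.coe_mul, ← Matrix.SpecialLinearGroup.coe_mul,
      ((Commute.refl A).zpow_right m).eq]
  rcases four_cases _ _ hc A.det_coe (A ^ m).det_coe ht hD with h | h | h | h
  · left; exact Subtype.ext h
  · right; left; exact Subtype.ext (by rw [h, Matrix.SpecialLinearGroup.coe_neg])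
  · right; right; left; exact Subtype.ext (by rw [h, Matrix.SpecialLinearGroup.coe_inv])
  · right; right; right
    exact Subtype.ext (by rw [h, Matrix.SpecialLinearGroup.coe_neg, Matrix.SpecialLinearGroup.coe_inv])

end PslAux


/-- Let `O` be a semisimple conjugacy class of `PSL(2,q)` (the class of `g`, a nontrivial element
whose order is coprime to the characteristic `p`) and `m` an integer coprime to `o(O) = orderOf g`.
Then `O^[m] = O` if and only if `o(O) ∣ m - 1` or `o(O) ∣ m + 1`. -/
theorem psl_two_semisimple_class_power_eq_iff (p n q : ℕ) (hp : p.Prime) (hn : n ≠ 0)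
    (hq : q = p ^ n) (F : Type) [Field F] [Fintype F] (hF : Fintype.card F = q)
    (g : Matrix.ProjectiveSpecialLinearGroup (Fin 2) F) (hg : g ≠ 1)
    (hss : Nat.Coprime (orderOf g) p) (m : ℤ) (hm : Int.gcd m (orderOf g) = 1) :
    {y | ∃ x, IsConj g x ∧ y = x ^ m} = {x | IsConj g x} ↔
      ((orderOf g : ℤ) ∣ m - 1 ∨ (orderOf g : ℤ) ∣ m + 1) := by

  have hchar : CharP F p := by
    have : Fact p.Prime := ⟨hp⟩
    exact charP_of_card_eq_prime_pow (f := n) (by rw [hF, hq])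
  obtain ⟨A, rfl⟩ := QuotientGroup.mk_surjective g
  have hD : (A : Matrix (Fin 2) (Fin 2) F).trace ^ 2 ≠ 4 := by
    intro h
    apply hg
    have h1 := PslAux.trace_ne p hp A h
    have h2 : (QuotientGroup.mk A : Matrix.ProjectiveSpecialLinearGroup (Fin 2) F) ^ p = 1 := by
      rw [← QuotientGroup.mk_pow]
      exact (QuotientGroup.eq_one_iff _).mpr ((PslAux.mem_center _).mpr h1)
    have h3 := orderOf_dvd_of_pow_eq_one h2
    exact orderOf_eq_one_iff.mp (hss.eq_one_of_dvd h3)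
  have hinv : IsConj (QuotientGroup.mk A : Matrix.ProjectiveSpecialLinearGroup (Fin 2) F)
      (QuotientGroup.mk A)⁻¹ :=
    (QuotientGroup.mk' (Subgroup.center (Matrix.SpecialLinearGroup (Fin 2) F))).map_isConj
      (PslAux.conj_inv A hD)
  constructor
  · intro h
    have h1 : IsConj (QuotientGroup.mk A : Matrix.ProjectiveSpecialLinearGroup (Fin 2) F)
        ((QuotientGroup.mk A) ^ m) := by
      have : (QuotientGroup.mk A : Matrix.ProjectiveSpecialLinearGroup (Fin 2) F) ^ m ∈
        {y | ∃ x, IsConj (QuotientGroup.mk A : Matrix.ProjectiveSpecialLinearGroup (Fin 2) F) x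
          ∧ y = x ^ m} := ⟨_, IsConj.refl _, rfl⟩
      rw [h] at this
      exact this
    obtain ⟨c, hc⟩ := isConj_iff.mp h1
    obtain ⟨B, rfl⟩ := QuotientGroup.mk_surjective c
    have h2 := (PslAux.mk_eq (B * A * B⁻¹) (A ^ m)).mp hc
    rw [orderOf_dvd_iff_zpow_eq_one, orderOf_dvd_iff_zpow_eq_one, zpow_sub_one, zpow_add_one,
      mul_inv_eq_one, mul_eq_one_iff_eq_inv]
    rcases PslAux.pow_cases A m hD B h2 with h | h | h | h
    · left; exact ((PslAux.mk_eq A (A ^ m)).mpr (Or.inl h)).symm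
    · left; exact ((PslAux.mk_eq A (A ^ m)).mpr (Or.inr h)).symm
    · right; exact ((PslAux.mk_eq A⁻¹ (A ^ m)).mpr (Or.inl h)).symm
    · right; exact ((PslAux.mk_eq A⁻¹ (A ^ m)).mpr (Or.inr h)).symm
  · generalize (QuotientGroup.mk A : Matrix.ProjectiveSpecialLinearGroup (Fin 2) F) = g at *
    have hord : ∀ k : ℤ, (orderOf g : ℤ) ∣ k → ∀ x, IsConj g x → x ^ k = 1 := by
      intro k hk x hx
      obtain ⟨c, rfl⟩ := isConj_iff.mp hx
      rw [conj_zpow, orderOf_dvd_iff_zpow_eq_one.mp hk]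
      simp
    have hxi : ∀ x, IsConj g x → IsConj g x⁻¹ := by
      intro x hx
      refine hinv.trans ?_
      obtain ⟨c, rfl⟩ := isConj_iff.mp hx
      exact isConj_iff.mpr ⟨c, by group⟩
    rintro (h | h)
    · have key : ∀ x, IsConj g x → x ^ m = x := by
        intro x hx
        have := hord _ h x hx
        rwa [zpow_sub_one, mul_inv_eq_one] at this
      ext y
      constructor
      · rintro ⟨x, hx, rfl⟩
        rw [key x hx]; exact hx
      · intro hy
        exact ⟨y, hy, (key y hy).symm⟩
    · have key : ∀ x, IsConj g x → x ^ m = x⁻¹ := by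
        intro x hx
        have := hord _ h x hx
        rwa [zpow_add_one, mul_eq_one_iff_eq_inv] at this
      ext y
      constructor
      · rintro ⟨x, hx, rfl⟩
        rw [key x hx]; exact hxi x hx
      · intro hy
        exact ⟨y⁻¹, hxi y hy, by rw [key _ (hxi y hy), inv_inv]⟩
end

section
/- Let q > 4 be a prime power with q ≠ 9, and let X be the conjugacy class of involutions of PSL(2,q) with q odd. Then for every x ∈ X the centralizer C_{PSL(2,q)}(x) is a dihedral group of order q+1 or q-1. -/
theorem dihedral_recog {G : Type*} [Group G] (H : Subgroup G) [IsCyclic H] (m : ℕ)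
    (hm : Nat.card H = m) (t : G) (ht : t ∉ H) (hsq : ∀ g, g ∉ H → g * g = 1)
    (hmul : ∀ g k, g ∉ H → k ∉ H → g * k ∈ H) : Nonempty (G ≃* DihedralGroup m) := by
  subst hm
  let e : Multiplicative (ZMod (Nat.card H)) ≃* H := zmodCyclicMulEquiv ‹_›
  have htt := hsq t ht
  have hinv : ∀ h : H, (h : G) * t = t * ((h⁻¹ : H) : G) := by
    intro h
    have h1 : t * (h : G) ∉ H := fun hc => ht ((H.mul_mem_cancel_right h.2).1 hc)
    have h2 := hsq _ h1
    rw [Subgroup.coe_inv]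
    rw [eq_mul_inv_iff_mul_eq]
    have : t * (h * t * h) = t * t := by rw [htt, ← h2]; group
    simpa [mul_assoc] using mul_left_cancel this
  let f0 : DihedralGroup (Nat.card H) → G := fun d => match d with
    | .r i => (e (Multiplicative.ofAdd i) : G)
    | .sr i => t * (e (Multiplicative.ofAdd i) : G)
  let f : DihedralGroup (Nat.card H) →* G := MonoidHom.mk' f0 (by
    rintro (i | i) (j | j)
    · simp [f0]
    · simp only [DihedralGroup.r_mul_sr, f0]
      rw [← mul_assoc, hinv, mul_assoc, ← Subgroup.coe_mul, ← map_inv, ← map_mul]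
      congr 3
      rw [← ofAdd_neg, ← ofAdd_add]; congr 1; ring
    · simp only [DihedralGroup.sr_mul_r, f0]
      rw [mul_assoc, ← Subgroup.coe_mul, ← map_mul]; rfl
    · simp only [DihedralGroup.sr_mul_sr, f0]
      rw [mul_assoc, ← mul_assoc _ t, hinv, mul_assoc, ← mul_assoc t t, htt, one_mul,
        ← Subgroup.coe_mul, ← map_inv, ← map_mul]
      congr 2
      rw [← ofAdd_neg, ← ofAdd_add]; congr 1; ring)
  refine ⟨(MulEquiv.ofBijective f ⟨?_, ?_⟩).symm⟩
  · rw [injective_iff_map_eq_one]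
    rintro (i | i) h
    · change (e (Multiplicative.ofAdd i) : G) = 1 at h
      rw [OneMemClass.coe_eq_one, map_eq_one_iff e e.injective] at h
      rw [DihedralGroup.one_def]; congr 1
    · change t * (e (Multiplicative.ofAdd i) : G) = 1 at h
      exact absurd ((H.mul_mem_cancel_right (e (Multiplicative.ofAdd i)).2).1 (h ▸ H.one_mem)) ht
  · intro g
    by_cases hg : g ∈ H
    · refine ⟨.r (Multiplicative.toAdd (e.symm ⟨g, hg⟩)), ?_⟩
      change ((e (e.symm ⟨g, hg⟩) : H) : G) = g
      simp
    · refine ⟨.sr (Multiplicative.toAdd (e.symm ⟨t * g, hmul _ _ ht hg⟩)), ?_⟩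
      change t * ((e (e.symm ⟨t * g, hmul _ _ ht hg⟩) : H) : G) = g
      simp [← mul_assoc, htt]

theorem card_circle (F : Type) [Field F] [Fintype F] (h2 : (2 : F) ≠ 0) :
    Nat.card {p : F × F // p.1 ^ 2 + p.2 ^ 2 = 1} = Fintype.card F + 1 ∨
    Nat.card {p : F × F // p.1 ^ 2 + p.2 ^ 2 = 1} + 1 = Fintype.card F := by
  classical
  let f : Option {t : F // t ^ 2 + 1 ≠ 0} → {p : F × F // p.1 ^ 2 + p.2 ^ 2 = 1} := fun o =>
    match o with
    | none => ⟨(-1, 0), by ring⟩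
    | some t => ⟨((1 - t.1 ^ 2) / (t.1 ^ 2 + 1), 2 * t.1 / (t.1 ^ 2 + 1)), by
        have := t.2
        simp only; field_simp; ring⟩
  have hne : ∀ t : {t : F // t ^ 2 + 1 ≠ 0}, (1 - t.1 ^ 2) / (t.1 ^ 2 + 1) + 1 ≠ 0 := by
    intro t h
    have := t.2
    field_simp at h
    exact h2 (by linear_combination h)
  have hf : Function.Bijective f := by
    constructor
    · rintro (_ | t) (_ | s) h
      · rfl
      · exfalso; simp only [f, Subtype.mk.injEq, Prod.mk.injEq] at h
        exact hne s (by rw [← h.1]; ring)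
      · exfalso; simp only [f, Subtype.mk.injEq, Prod.mk.injEq] at h
        exact hne t (by rw [h.1]; ring)
      · simp only [f, Subtype.mk.injEq, Prod.mk.injEq] at h
        congr 1
        obtain ⟨ha, hb⟩ := h
        have key : ∀ t : {t : F // t ^ 2 + 1 ≠ 0},
            t.1 = (2 * t.1 / (t.1 ^ 2 + 1)) / ((1 - t.1 ^ 2) / (t.1 ^ 2 + 1) + 1) := by
          intro t
          rw [eq_div_iff (hne t)]
          have := t.2
          field_simp
          ring
        ext
        rw [key t, key s, ha, hb]
    · rintro ⟨⟨a, b⟩, h⟩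
      simp only at h
      by_cases ha : a + 1 = 0
      · refine ⟨none, ?_⟩
        have ha' : a = -1 := by linear_combination ha
        have hb : b ^ 2 = 0 := by rw [ha'] at h; linear_combination h
        simp [f, ha', pow_eq_zero_iff] at hb ⊢
        exact hb.symm
      · have e1 : (b / (a + 1)) ^ 2 + 1 = 2 / (a + 1) := by
          field_simp; linear_combination h
        refine ⟨some ⟨b / (a + 1), by rw [e1]; exact div_ne_zero h2 ha⟩, ?_⟩
        simp only [f, Subtype.mk.injEq, Prod.mk.injEq, e1]
        constructor
        · field_simp; linear_combination -h
        · field_simp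
  have hc : Nat.card {p : F × F // p.1 ^ 2 + p.2 ^ 2 = 1}
      = Fintype.card {t : F // t ^ 2 + 1 ≠ 0} + 1 := by
    rw [← Nat.card_congr (Equiv.ofBijective f hf), Nat.card_eq_fintype_card, Fintype.card_option]
  rw [hc]
  have h3 : Fintype.card {t : F // t ^ 2 + 1 ≠ 0} + Fintype.card {t : F // t ^ 2 + 1 = 0}
      = Fintype.card F := by
    rw [Fintype.card_subtype_compl]
    have := Fintype.card_subtype_le (fun t : F => t ^ 2 + 1 = 0)
    omega
  by_cases hi : ∃ i : F, i ^ 2 + 1 = 0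
  · right
    obtain ⟨i, hi⟩ := hi
    have : Fintype.card {t : F // t ^ 2 + 1 = 0} = 2 := by
      rw [Fintype.card_subtype]
      have : (Finset.univ.filter fun t : F => t ^ 2 + 1 = 0) = {i, -i} := by
        ext t
        simp only [Finset.mem_filter, Finset.mem_univ, true_and, Finset.mem_insert,
          Finset.mem_singleton]
        rw [← sq_eq_sq_iff_eq_or_eq_neg]
        constructor <;> intro h
        · linear_combination h - hi
        · linear_combination h + hi
      rw [this, Finset.card_pair]
      intro h
      have h0 : i = 0 := by
        have : 2 * i = 0 := by linear_combination h
        exact (mul_eq_zero.1 this).resolve_left h2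
      simp [h0] at hi
    omega
  · left
    have : Fintype.card {t : F // t ^ 2 + 1 = 0} = 0 := by
      rw [Fintype.card_eq_zero_iff]
      exact ⟨fun t => hi ⟨t.1, t.2⟩⟩
    omega

abbrev SL2 (F : Type) [Field F] := Matrix.SpecialLinearGroup (Fin 2) F

theorem sl2_mk {F : Type} [Field F] (M : Matrix (Fin 2) (Fin 2) F) (h : M.det = 1) :
    ∃ G : SL2 F, (G : Matrix (Fin 2) (Fin 2) F) = M := ⟨⟨M, h⟩, rfl⟩

theorem sl2_ext {F : Type} [Field F] (A B : SL2 F) (h1 : A 0 0 = B 0 0) (h2 : A 0 1 = B 0 1)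
    (h3 : A 1 0 = B 1 0) (h4 : A 1 1 = B 1 1) : A = B := by
  ext i j
  fin_cases i <;> fin_cases j <;> assumption

theorem sl2_mul {F : Type} [Field F] (A B : SL2 F) (i j : Fin 2) :
    (A * B) i j = A i 0 * B 0 j + A i 1 * B 1 j := by
  rw [Matrix.SpecialLinearGroup.coe_mul, Matrix.mul_apply, Fin.sum_univ_two]

theorem sl2_neg {F : Type} [Field F] (A : SL2 F) (i j : Fin 2) : (-A) i j = - A i j := by
  rw [Matrix.SpecialLinearGroup.coe_neg, Matrix.neg_apply]

theorem sl2_det {F : Type} [Field F] (A : SL2 F) : A 0 0 * A 1 1 - A 0 1 * A 1 0 = 1 := by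
  have := A.2
  rwa [Matrix.det_fin_two] at this

theorem sl2_center {F : Type} [Field F] (A : SL2 F) :
    A ∈ Subgroup.center (SL2 F) ↔ A = 1 ∨ A = -1 := by
  rw [Matrix.SpecialLinearGroup.mem_center_iff]
  constructor
  · rintro ⟨r, hr, h⟩
    have hr' : r ^ 2 = 1 := by simpa using hr
    rcases sq_eq_sq_iff_eq_or_eq_neg.1 (hr'.trans (one_pow 2).symm) with rfl | rfl
    · left; ext i j; rw [← h]; simp
    · right; ext i j; rw [← h]
      fin_cases i <;> fin_cases j <;> simp
  · rintro (rfl | rfl)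
    · exact ⟨1, by simp, by simp⟩
    · refine ⟨-1, by simp, ?_⟩
      ext i j
      fin_cases i <;> fin_cases j <;> simp

theorem sl2_sq {F : Type} [Field F] (A : SL2 F) (h : A 0 0 + A 1 1 = 0) : A * A = -1 := by
  have hd := sl2_det A
  apply sl2_ext <;> rw [sl2_mul, sl2_neg] <;> simp
  · linear_combination A 0 0 * h - hd
  · linear_combination A 0 1 * h
  · linear_combination A 1 0 * h
  · linear_combination A 1 1 * h - hd

theorem sl2_invol {F : Type} [Field F] (S : SL2 F) (hS : S ∉ Subgroup.center (SL2 F))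
    (hSS : S * S ∈ Subgroup.center (SL2 F)) : S 0 0 + S 1 1 = 0 := by
  by_contra htr
  apply hS
  have key : S 0 1 = 0 ∧ S 1 0 = 0 ∧ S 0 0 = S 1 1 := by
    have hd : ∀ i j, (S * S) i j = (S * S) 0 0 * (1 : Matrix (Fin 2) (Fin 2) F) i j := by
      rcases (sl2_center _).1 hSS with h | h <;> rw [h] <;> intro i j
      · simp
      · rw [sl2_neg, sl2_neg]; simp
    have h01 := hd 0 1
    have h10 := hd 1 0
    have h11 := hd 1 1
    simp [sl2_mul] at h01 h10 h11
    refine ⟨?_, ?_, ?_⟩ <;> apply mul_left_cancel₀ htr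
    · linear_combination h01
    · linear_combination h10
    · linear_combination -h11
  obtain ⟨h1, h2, h3⟩ := key
  have hd := sl2_det S
  rw [sl2_center]
  rw [h1, ← h3] at hd
  have : (S 0 0) ^ 2 = 1 := by linear_combination hd
  rcases sq_eq_sq_iff_eq_or_eq_neg.1 (this.trans (one_pow 2).symm) with h | h
  · left; apply sl2_ext <;> simp [h1, h2, ← h3, h]
  · right; apply sl2_ext <;> rw [sl2_neg] <;> simp [h1, h2, ← h3, h]

theorem sl2_anti {F : Type} [Field F] (h2 : (2 : F) ≠ 0) (S G : SL2 F)
    (hS : S 0 0 + S 1 1 = 0) (h : G * S = -(S * G)) : G 0 0 + G 1 1 = 0 := by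
  have hd := sl2_det S
  have e := fun i j => congrArg (fun A : SL2 F => A i j) h
  simp only [sl2_mul, sl2_neg] at e
  have e00 := e 0 0
  have e01 := e 0 1
  have e10 := e 1 0
  have e11 := e 1 1
  have hs : S 1 1 = - S 0 0 := by linear_combination hS
  rw [hs] at hd e01 e10 e11
  have : 2 * (G 0 0 + G 1 1) = 0 := by
    linear_combination (-S 0 0) * e00 - S 1 0 * e01 - S 0 1 * e10 + S 0 0 * e11 -
      2 * (G 0 0 + G 1 1) * hd
  exact (mul_eq_zero.1 this).resolve_left h2

theorem sum_sq_neg_one (F : Type) [Field F] [Fintype F] (hc : Fintype.card F % 2 = 1) :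
    ∃ r s : F, r ^ 2 + s ^ 2 = -1 := by
  obtain ⟨a, b, h⟩ := FiniteField.exists_root_sum_quadratic (R := F)
    (f := Polynomial.X ^ 2) (g := Polynomial.X ^ 2 - Polynomial.C (-1))
    (Polynomial.degree_X_pow 2) (Polynomial.degree_X_pow_sub_C (by decide) _) hc
  refine ⟨a, b, ?_⟩
  simp at h
  linear_combination h

theorem sl2_exists_anti {F : Type} [Field F] [Fintype F] (hc : Fintype.card F % 2 = 1)
    (h2 : (2 : F) ≠ 0) (S : SL2 F) (hS : S 0 0 + S 1 1 = 0) : ∃ G : SL2 F, G * S = -(S * G) := by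
  have hd := sl2_det S
  have hs : S 1 1 = - S 0 0 := by linear_combination hS
  rw [hs] at hd
  suffices h : ∃ x y z : F, 2 * S 0 0 * x + S 0 1 * z + S 1 0 * y = 0 ∧ - x ^ 2 - y * z = 1 by
    obtain ⟨x, y, z, h, hdet⟩ := h
    obtain ⟨G, hG⟩ := sl2_mk !![x, y; z, -x]
      (by rw [Matrix.det_fin_two_of]; linear_combination hdet)
    have g00 : G 0 0 = x := by rw [hG]; simp
    have g01 : G 0 1 = y := by rw [hG]; simp
    have g10 : G 1 0 = z := by rw [hG]; simp
    have g11 : G 1 1 = -x := by rw [hG]; simp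
    refine ⟨G, ?_⟩
    apply sl2_ext <;> rw [sl2_neg, sl2_mul, sl2_mul] <;> simp only [g00, g01, g10, g11, hs]
    · linear_combination h
    · ring
    · ring
    · linear_combination h
  by_cases hb : S 0 1 = 0
  · rw [hb] at hd ⊢
    have ha : S 0 0 ≠ 0 := by
      intro h; simp [h] at hd
    exact ⟨-S 1 0 / (2 * S 0 0), 1, -1 - (-S 1 0 / (2 * S 0 0)) ^ 2, by field_simp; ring, by ring⟩
  · obtain ⟨r, s, hrs⟩ := sum_sq_neg_one F hc
    refine ⟨r + S 0 0 * s, S 0 1 * s, -(2 * S 0 0 * r + (S 0 0 ^ 2 - 1) * s) / S 0 1, ?_, ?_⟩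
    · field_simp
      linear_combination (-s) * hd
    · field_simp
      linear_combination -hrs

theorem sl2_comm_form {F : Type} [Field F] (h2 : (2 : F) ≠ 0) (S G : SL2 F)
    (hS : S 0 0 + S 1 1 = 0) (h : G * S = S * G) :
    ∃ a b : F, a ^ 2 + b ^ 2 = 1 ∧ (G : Matrix (Fin 2) (Fin 2) F) = a • 1 + b • S.1 := by
  have hd := sl2_det S
  have hdG := sl2_det G
  have e := fun i j => congrArg (fun A : SL2 F => A i j) h
  simp only [sl2_mul] at e
  have e00 := e 0 0
  have e01 := e 0 1
  have e10 := e 1 0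
  have hs : S 1 1 = - S 0 0 := by linear_combination hS
  rw [hs] at hd e01 e10
  obtain ⟨b, hb⟩ : ∃ b, b = -(G 0 0 * S 0 0 + G 0 1 * S 1 0 + G 1 0 * S 0 1 - G 1 1 * S 0 0) / 2 :=
    ⟨_, rfl⟩
  obtain ⟨a, ha⟩ : ∃ a, a = (G 0 0 + G 1 1) / 2 := ⟨_, rfl⟩
  have hb' : 2 * b = -(G 0 0 * S 0 0 + G 0 1 * S 1 0 + G 1 0 * S 0 1 - G 1 1 * S 0 0) := by
    rw [hb]; field_simp
  have ha' : 2 * a = G 0 0 + G 1 1 := by rw [ha]; field_simp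
  have g00 : G 0 0 = a + b * S 0 0 := by
    apply mul_left_cancel₀ h2
    linear_combination -ha' - S 0 0 * hb' - (G 0 0 - G 1 1) * hd + S 0 1 * e10 + S 0 0 * e00
  have g11 : G 1 1 = a - b * S 0 0 := by
    linear_combination -ha' - g00
  have g01 : G 0 1 = b * S 0 1 := by
    apply mul_left_cancel₀ h2
    linear_combination - S 0 1 * hb' - 2 * G 0 1 * hd + S 0 0 * e01 - S 0 1 * e00
  have g10 : G 1 0 = b * S 1 0 := by
    apply mul_left_cancel₀ h2
    linear_combination - S 1 0 * hb' - 2 * G 1 0 * hd - S 0 0 * e10 + S 1 0 * e00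
  refine ⟨a, b, ?_, ?_⟩
  · rw [g00, g01, g10, g11] at hdG
    linear_combination hdG - b ^ 2 * hd
  · ext i j
    fin_cases i <;> fin_cases j <;> simp [g00, g01, g10, g11, hs] <;> ring

theorem sl2_form_unique {F : Type} [Field F] (h2 : (2 : F) ≠ 0) (S : SL2 F)
    (hS : S 0 0 + S 1 1 = 0) (a b c d : F)
    (h : a • (1 : Matrix (Fin 2) (Fin 2) F) + b • S.1 = c • 1 + d • S.1) : a = c ∧ b = d := by
  have hd := sl2_det S
  have e := fun i j => congrArg (fun A : Matrix (Fin 2) (Fin 2) F => A i j) h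
  have hs : S 1 1 = - S 0 0 := by linear_combination hS
  have e00 := e 0 0
  have e01 := e 0 1
  have e10 := e 1 0
  have e11 := e 1 1
  simp [hs] at e00 e01 e10 e11
  rw [hs] at hd
  have hac : a = c := by
    apply mul_left_cancel₀ h2
    linear_combination e00 + e11
  refine ⟨hac, ?_⟩
  by_contra hbd
  have hbd' := sub_ne_zero.2 hbd
  have z : ∀ y, b * y = d * y → y = 0 := fun y hy => by
    have : (b - d) * y = 0 := by linear_combination hy
    exact (mul_eq_zero.1 this).resolve_left hbd'
  have z01 : S 0 1 = 0 := by
    rcases e01 with h | h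
    · exact absurd h hbd
    · exact h
  have z00 : S 0 0 = 0 := z _ (by linear_combination e00 - hac)
  simp [z00, z01] at hd

/-- the centralizer of `S` in `SL2` is parametrized by the circle -/
theorem sl2_card_centralizer {F : Type} [Field F] (h2 : (2 : F) ≠ 0) (S : SL2 F)
    (hS : S 0 0 + S 1 1 = 0) : Nat.card (Subgroup.centralizer {S} : Subgroup (SL2 F)) =
      Nat.card {p : F × F // p.1 ^ 2 + p.2 ^ 2 = 1} := by
  symm
  have hd := sl2_det S
  have hs : S 1 1 = - S 0 0 := by linear_combination hS
  rw [hs] at hd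
  have hex : ∀ p : {p : F × F // p.1 ^ 2 + p.2 ^ 2 = 1}, ∃ G : SL2 F,
      (G : Matrix (Fin 2) (Fin 2) F) = p.1.1 • 1 + p.1.2 • S.1 := fun p => sl2_mk _ (by
    rw [Matrix.det_fin_two]
    simp [hs]
    linear_combination p.2 + p.1.2 ^ 2 * hd)
  choose f0 hf0 using hex
  have hmem : ∀ p, f0 p ∈ (Subgroup.centralizer {S} : Subgroup (SL2 F)) := by
    intro p
    rw [Subgroup.mem_centralizer_singleton_iff]
    apply Subtype.ext
    rw [Matrix.SpecialLinearGroup.coe_mul, Matrix.SpecialLinearGroup.coe_mul, hf0]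
    simp [mul_add, add_mul]
  refine Nat.card_congr (Equiv.ofBijective (fun p =>
    (⟨f0 p, hmem p⟩ : (Subgroup.centralizer {S} : Subgroup (SL2 F)))) ⟨?_, ?_⟩)
  · intro p r e
    have e' : (f0 p).1 = (f0 r).1 :=
      congrArg (fun G : (Subgroup.centralizer {S} : Subgroup (SL2 F)) => G.1.1) e
    rw [hf0, hf0] at e'
    obtain ⟨h1, h3⟩ := sl2_form_unique h2 S hS _ _ _ _ e'
    exact Subtype.ext (Prod.ext h1 h3)
  · rintro ⟨G, hG⟩
    rw [Subgroup.mem_centralizer_singleton_iff] at hG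
    obtain ⟨a, b, hab, e⟩ := sl2_comm_form h2 S G hS (by first | exact hG | exact hG.symm)
    exact ⟨⟨(a, b), hab⟩, Subtype.ext (Subtype.ext ((hf0 _).trans e.symm))⟩

theorem sl2_cyclic {F : Type} [Field F] [Finite F] (h2 : (2 : F) ≠ 0) (S : SL2 F)
    (hS : S 0 0 + S 1 1 = 0) : IsCyclic (Subgroup.centralizer {S} : Subgroup (SL2 F)) := by
  have hform : ∀ G : (Subgroup.centralizer {S} : Subgroup (SL2 F)), ∃ a b : F,
      a ^ 2 + b ^ 2 = 1 ∧ (G.1.1 : Matrix (Fin 2) (Fin 2) F) = a • 1 + b • S.1 := fun G => by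
    have hG := G.2
    rw [Subgroup.mem_centralizer_singleton_iff] at hG
    exact sl2_comm_form h2 S G.1 hS (by first | exact hG | exact hG.symm)
  choose a b hab hf using hform
  let L := AlgebraicClosure F
  obtain ⟨i, hi⟩ := IsAlgClosed.exists_pow_nat_eq (-1 : L) (n := 2) (by norm_num)
  have hSS : S.1 * S.1 = -1 := congrArg Subtype.val (sl2_sq S hS)
  let φ := algebraMap F L
  let f : (Subgroup.centralizer {S} : Subgroup (SL2 F)) →* L :=
    { toFun := fun G => φ (a G) + φ (b G) * i
      map_one' := by
        obtain ⟨h1, h3⟩ := sl2_form_unique h2 S hS (a 1) (b 1) 1 0 (by rw [← hf]; simp)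
        rw [h1, h3]; simp
      map_mul' := by
        intro G K
        obtain ⟨h1, h3⟩ := sl2_form_unique h2 S hS (a (G * K)) (b (G * K))
          (a G * a K - b G * b K) (a G * b K + b G * a K) (by
            rw [← hf]
            change G.1.1 * K.1.1 = _
            rw [hf, hf]
            simp only [mul_add, add_mul, smul_mul_assoc, mul_smul_comm, one_mul, mul_one, hSS]
            module)
        rw [h1, h3]
        simp only [map_add, map_sub, map_mul]
        linear_combination (-φ (b G) * φ (b K)) * hi }
  refine isCyclic_of_injective_ringHom f ?_
  rw [injective_iff_map_eq_one]
  intro G hG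
  change φ (a G) + φ (b G) * i = 1 at hG
  have hn : φ (a G) ^ 2 + φ (b G) ^ 2 = 1 := by
    rw [← map_pow, ← map_pow, ← map_add, hab, map_one]
  have hG' : φ (a G) - φ (b G) * i = 1 := by
    linear_combination hn - (φ (a G) - φ (b G) * i) * hG - φ (b G) ^ 2 * hi
  have h2L : (2 : L) ≠ 0 := by
    intro h; apply h2; apply φ.injective; rw [map_ofNat, map_zero]; exact h
  have ha : a G = 1 := by
    apply φ.injective
    apply mul_left_cancel₀ h2L
    rw [map_one]
    linear_combination hG + hG'
  have hb : b G = 0 := by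
    have := hab G
    rw [ha] at this
    have : b G ^ 2 = 0 := by linear_combination this
    exact pow_eq_zero_iff (two_ne_zero) |>.1 this
  apply Subtype.ext
  apply Subtype.ext
  rw [hf, ha, hb]
  simp

/-- Let `q > 4` be an odd prime power with `q ≠ 9`, and let `X` be the conjugacy class of
involutions of `PSL(2,q)`. Then for every `x ∈ X` the centralizer of `x` in `PSL(2,q)` is a
dihedral group of order `q + 1` or `q - 1`. -/
theorem psl_two_involution_centralizer_dihedral (p n q : ℕ) (hp : p.Prime) (hn : n ≠ 0)
    (hq : q = p ^ n) (h4 : 4 < q) (h9 : q ≠ 9) (hodd : Odd q)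
    (F : Type) [Field F] [Fintype F] (hF : Fintype.card F = q)
    (x : Matrix.ProjectiveSpecialLinearGroup (Fin 2) F) (hx : orderOf x = 2) :
    Nonempty (↥(Subgroup.centralizer {x}) ≃* DihedralGroup ((q + 1) / 2)) ∨
      Nonempty (↥(Subgroup.centralizer {x}) ≃* DihedralGroup ((q - 1) / 2)) := by
  have hc : Fintype.card F % 2 = 1 := by rw [hF]; exact Nat.odd_iff.1 hodd
  have h2 : (2 : F) ≠ 0 := Ring.two_ne_zero (fun h => by
    have := FiniteField.even_card_of_char_two h
    omega)
  let π : SL2 F →* Matrix.ProjectiveSpecialLinearGroup (Fin 2) F :=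
    QuotientGroup.mk' (Subgroup.center (SL2 F))
  have hπs : Function.Surjective π := QuotientGroup.mk'_surjective _
  have hker : ∀ g, π g = 1 ↔ g = 1 ∨ g = -1 := fun g => by
    rw [← sl2_center]; exact QuotientGroup.eq_one_iff g
  obtain ⟨S, rfl⟩ := hπs x
  have hS : S 0 0 + S 1 1 = 0 := by
    apply sl2_invol
    · rw [sl2_center, ← hker]
      intro h
      rw [h] at hx; simp at hx
    · rw [sl2_center, ← hker, map_mul, ← pow_two]
      exact orderOf_dvd_iff_pow_eq_one.1 (dvd_of_eq hx)
  have hneg : ∀ g, π (-g) = π g := fun g => by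
    have : -g = -1 * g := by simp
    rw [this, map_mul, (hker (-1)).2 (Or.inr rfl), one_mul]
  have heq : ∀ g k, π g = π k → g = k ∨ g = -k := by
    intro g k h
    have : π (g * k⁻¹) = 1 := by rw [map_mul, map_inv, h, mul_inv_cancel]
    rcases (hker _).1 this with h | h
    · left; exact mul_inv_eq_one.1 h
    · right; rw [mul_inv_eq_iff_eq_mul] at h; simpa using h
  have hne1 : (-1 : SL2 F) ≠ 1 := by
    intro h
    have := congrArg (fun A : SL2 F => A 0 0) h
    simp only [sl2_neg] at this
    simp at this
    exact h2 (by linear_combination -this)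
  set A : Subgroup (SL2 F) := Subgroup.centralizer {S} with hA
  have memA : ∀ g, g ∈ A ↔ g * S = S * g := fun g => by
    rw [hA, Subgroup.mem_centralizer_singleton_iff]
  have memC : ∀ g, g ∈ Subgroup.centralizer {π S} ↔ g * π S = π S * g := fun g => by
    rw [Subgroup.mem_centralizer_singleton_iff]
  have hAcyc : IsCyclic A := sl2_cyclic h2 S hS
  let ψ : A →* Subgroup.centralizer {π S} :=
    (π.comp A.subtype).codRestrict _ (fun g => by
      rw [memC]
      change π g.1 * π S = π S * π g.1
      rw [← map_mul, ← map_mul, (memA _).1 g.2])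
  have hcyc : IsCyclic ψ.range := isCyclic_of_surjective ψ.rangeRestrict ψ.rangeRestrict_surjective
  have hcard : 2 * Nat.card ψ.range = Nat.card A := by
    rw [← Subgroup.index_ker, ← Subgroup.card_mul_index ψ.ker]
    congr 1
    symm
    have hmem : (-1 : SL2 F) ∈ A := by rw [memA]; simp
    have hk : ∀ g : A, g ∈ ψ.ker ↔ g = 1 ∨ g = ⟨-1, hmem⟩ := by
      intro g
      rw [MonoidHom.mem_ker, ← Subtype.val_inj]
      change π g.1 = 1 ↔ _
      rw [hker, ← Subtype.val_inj, ← Subtype.val_inj]; rfl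
    have : (ψ.ker : Set A) = {1, ⟨-1, hmem⟩} := by
      ext g; exact hk g
    change Nat.card (ψ.ker : Set A) = 2
    rw [Nat.card_coe_set_eq, this, Set.ncard_pair]
    intro h
    exact hne1 (congrArg Subtype.val h).symm
  have hout : ∀ g : Subgroup.centralizer {π S}, g ∉ ψ.range →
      ∃ G : SL2 F, π G = g ∧ G * S = -(S * G) := by
    rintro ⟨g, hg⟩ hn
    obtain ⟨G, rfl⟩ := hπs g
    refine ⟨G, rfl, ?_⟩
    rw [memC, ← map_mul, ← map_mul] at hg
    rcases heq _ _ hg with h | h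
    · exact absurd ⟨⟨G, (memA G).2 h⟩, rfl⟩ hn
    · exact h
  obtain ⟨T, hT⟩ := sl2_exists_anti hc h2 S hS
  have hTC : π T ∈ Subgroup.centralizer {π S} := by
    rw [memC, ← map_mul, ← map_mul, hT, hneg]
  have main : Nonempty (↥(Subgroup.centralizer {π S}) ≃* DihedralGroup (Nat.card ψ.range)) := by
    refine dihedral_recog ψ.range _ rfl ⟨π T, hTC⟩ ?_ ?_ ?_
    · rintro ⟨⟨G, hG⟩, h⟩
      have h' : π G = π T := congrArg Subtype.val h
      have hGS := (memA G).1 hG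
      have hTS : T * S = S * T := by
        rcases heq _ _ h' with h | h
        · rw [← h, hGS]
        · have : T = -G := by rw [h, neg_neg]
          rw [this, neg_mul, mul_neg, hGS]
      rw [hTS] at hT
      have : (-1 : SL2 F) = 1 := by
        apply mul_right_cancel (b := S * T)
        rw [one_mul, neg_mul, one_mul, ← hT]
      exact hne1 this
    · intro g hg
      obtain ⟨G, h1, h3⟩ := hout g hg
      apply Subtype.ext
      change g.1 * g.1 = 1
      rw [← h1, ← map_mul, hker]
      right
      exact sl2_sq G (sl2_anti h2 S G hS h3)
    · intro g k hg hk
      obtain ⟨G, h1, h3⟩ := hout g hg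
      obtain ⟨K, h5, h6⟩ := hout k hk
      refine ⟨⟨G * K, ?_⟩, ?_⟩
      · rw [memA, mul_assoc, h6, mul_neg, ← mul_assoc, h3, neg_mul, neg_neg, mul_assoc]
      · apply Subtype.ext
        change π (G * K) = g.1 * k.1
        rw [map_mul, h1, h5]
  have hcA := sl2_card_centralizer h2 S hS
  rw [← hA] at hcA
  rcases card_circle F h2 with h | h
  · left
    have : (q + 1) / 2 = Nat.card ψ.range := by omega
    rw [this]; exact main
  · right
    have : (q - 1) / 2 = Nat.card ψ.range := by omega
    rw [this]; exact main
end
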